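/- Let M ∈ ℝ^{2n×2n} be symmetric positive-definite with symplectic eigenvalues d₁ ≤ ... ≤ dₙ. Then for every integer 1 ≤ k ≤ n, the minimum of the function f(X) = tr(XᵀMX) over all X ∈ ℝ^{2n×2k} satisfying XᵀJ_{2n}X = J_{2k} is attained and equals 2(d₁ + ... + d_k). -/

import Mathlib

open Matrix

noncomputable section

/-- Index type for `2n`-dimensional objects: first copy for indices `1..n`,
second copy for indices `n+1..2n`. -/
abbrev Idx (n : ℕ) := Fin n ⊕ Fin n

/-- The Poisson matrix `J_{2n} = [[0, I], [-I, 0]]`. -/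
def Jmat (n : ℕ) : Matrix (Idx n) (Idx n) ℝ := fromBlocks 0 1 (-1) 0

/-- `X ∈ Sp(2k, 2n)`, i.e. `Xᵀ J_{2n} X = J_{2k}`. -/
def Symplectic {n k : ℕ} (X : Matrix (Idx n) (Idx k) ℝ) : Prop :=
  Xᵀ * Jmat n * X = Jmat k

/-- `K ∈ OrSp(2n)`, i.e. `KᵀK = I` and `Kᵀ J K = J`. -/
def OrthoSymplectic {n : ℕ} (K : Matrix (Idx n) (Idx n) ℝ) : Prop :=
  Kᵀ * K = 1 ∧ Symplectic K

/-- The block-diagonal matrix `diag(D, D)` with `D = diagonal d`. -/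
def diagPair {n : ℕ} (d : Fin n → ℝ) : Matrix (Idx n) (Idx n) ℝ :=
  fromBlocks (diagonal d) 0 0 (diagonal d)

/-- The matrix `[[0, -Λ], [Λ, 0]]` with `Λ = diagonal lam`. -/
def offPair {k : ℕ} (lam : Fin k → ℝ) : Matrix (Idx k) (Idx k) ℝ :=
  fromBlocks 0 (-(diagonal lam)) (diagonal lam) 0

lemma Jmat_mul_self (n : ℕ) : Jmat n * Jmat n = -1 := by
  rw [Jmat, fromBlocks_multiply, ← fromBlocks_one, fromBlocks_neg]
  simp

lemma Jmat_transpose (n : ℕ) : (Jmat n)ᵀ = -Jmat n := by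
  simp [Jmat, fromBlocks_transpose, fromBlocks_neg]

lemma Jmat_mul_diagPair {n : ℕ} (d : Fin n → ℝ) : Jmat n * diagPair d = diagPair d * Jmat n := by
  rw [Jmat, diagPair, fromBlocks_multiply, fromBlocks_multiply]
  simp

lemma diagPair_eq_diagonal {n : ℕ} (d : Fin n → ℝ) :
    diagPair d = diagonal (Sum.elim d d) :=
  fromBlocks_diagonal d d

lemma trace_transpose_mul_diagPair_mul {n : ℕ} {ι : Type*} [Fintype ι] (d : Fin n → ℝ)
    (Y : Matrix (Idx n) ι ℝ) :
    (Yᵀ * diagPair d * Y).trace =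
      ∑ m, d m * ∑ c, (Y (Sum.inl m) c ^ 2 + Y (Sum.inr m) c ^ 2) := by
  rw [Matrix.mul_assoc, trace_mul_comm, diagPair_eq_diagonal, Matrix.mul_assoc]
  simp only [trace, diag_apply, diagonal_mul, Fintype.sum_sum_type, Sum.elim_inl, Sum.elim_inr]
  simp only [mul_apply, transpose_apply, ← Finset.sum_add_distrib, ← mul_add, pow_two]

lemma Symplectic.mul {n k : ℕ} {S : Matrix (Idx n) (Idx n) ℝ} {Y : Matrix (Idx n) (Idx k) ℝ}
    (hS : Symplectic S) (hY : Symplectic Y) : Symplectic (S * Y) := by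
  unfold Symplectic at *
  calc (S * Y)ᵀ * Jmat n * (S * Y) = Yᵀ * (Sᵀ * Jmat n * S) * Y := by
        simp only [transpose_mul, Matrix.mul_assoc]
    _ = Jmat k := by rw [hS, hY]

lemma Symplectic.exists_eq_mul {n k : ℕ} {S : Matrix (Idx n) (Idx n) ℝ} (hS : Symplectic S)
    {X : Matrix (Idx n) (Idx k) ℝ} (hX : Symplectic X) :
    ∃ Y : Matrix (Idx n) (Idx k) ℝ, Symplectic Y ∧ X = S * Y := by
  have hleft : (-(Jmat n * Sᵀ * Jmat n)) * S = 1 := by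
    have hS' : Sᵀ * Jmat n * S = Jmat n := hS
    rw [Matrix.neg_mul, Matrix.mul_assoc, Matrix.mul_assoc, ← Matrix.mul_assoc Sᵀ, hS',
      Jmat_mul_self, neg_neg]
  have hright := mul_eq_one_comm.mp hleft
  have hXeq : X = S * (-(Jmat n * Sᵀ * Jmat n) * X) := by
    rw [← Matrix.mul_assoc, hright, Matrix.one_mul]
  refine ⟨_, ?_, hXeq⟩
  generalize -(Jmat n * Sᵀ * Jmat n) * X = Y at hXeq
  subst hXeq
  unfold Symplectic at *
  rw [← hX]
  calc Yᵀ * Jmat n * Y = Yᵀ * (Sᵀ * Jmat n * S) * Y := by rw [hS]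
    _ = _ := by simp only [transpose_mul, Matrix.mul_assoc]

/-- The columns of `B` form an orthonormal basis of the kernel of `A`. -/
lemma exists_orthonormal_kernel_matrix {ι κ : Type*} [Fintype ι] [DecidableEq ι] [Fintype κ]
    (A : Matrix κ ι ℝ) :
    ∃ (r : ℕ) (B : Matrix ι (Fin r) ℝ), Bᵀ * B = 1 ∧ A * B = 0 ∧ Fintype.card ι = A.rank + r := by
  let K : Submodule ℝ (EuclideanSpace ℝ ι) :=
    LinearMap.ker (A.mulVecLin ∘ₗ (WithLp.linearEquiv 2 ℝ (ι → ℝ)).toLinearMap)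
  let b := stdOrthonormalBasis ℝ K
  refine ⟨Module.finrank ℝ K, Matrix.of fun i j => (b j : EuclideanSpace ℝ ι) i, ?_, ?_, ?_⟩
  · ext i j
    have h := orthonormal_iff_ite.mp b.orthonormal i j
    rw [Submodule.coe_inner, PiLp.inner_apply] at h
    rw [mul_apply, one_apply, ← h]
    exact Finset.sum_congr rfl fun _ _ => mul_comm _ _
  · ext i j
    have h : A.mulVec (b j : EuclideanSpace ℝ ι).ofLp = 0 := (b j).2
    exact congrFun h i
  · have h := LinearMap.finrank_range_add_finrank_ker
      (A.mulVecLin ∘ₗ (WithLp.linearEquiv 2 ℝ (ι → ℝ)).toLinearMap)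
    rw [LinearEquiv.range_comp] at h
    rw [finrank_euclideanSpace] at h
    exact h.symm

lemma trace_transpose_mul_self_nonneg {ι κ : Type*} [Fintype ι] [Fintype κ] (A : Matrix ι κ ℝ) :
    0 ≤ (Aᵀ * A).trace := by
  simp only [trace, diag_apply, mul_apply, transpose_apply]
  exact Finset.sum_nonneg fun _ _ => Finset.sum_nonneg fun _ _ => mul_self_nonneg _

/-- Compression to an orthonormal family does not increase the Frobenius norm. -/
lemma trace_compression_le {ι κ τ : Type*} [Fintype ι] [Fintype κ] [DecidableEq κ]
    [Fintype τ] [DecidableEq τ]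
    (Z : Matrix ι κ ℝ) (B : Matrix κ τ ℝ) (hB : Bᵀ * B = 1) :
    ((Z * B)ᵀ * (Z * B)).trace ≤ (Zᵀ * Z).trace := by
  have h := trace_transpose_mul_self_nonneg (Z - Z * B * Bᵀ)
  have hexp : (Z - Z * B * Bᵀ)ᵀ * (Z - Z * B * Bᵀ) =
      Zᵀ * Z - Zᵀ * (Z * B) * Bᵀ - B * ((Z * B)ᵀ * Z) + B * ((Z * B)ᵀ * (Z * B) * Bᵀ) := by
    simp only [transpose_sub, transpose_mul, transpose_transpose, Matrix.sub_mul, Matrix.mul_sub,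
      Matrix.mul_assoc]
    abel
  have h1 : (Zᵀ * (Z * B) * Bᵀ).trace = ((Z * B)ᵀ * (Z * B)).trace := by
    rw [trace_mul_comm, ← Matrix.mul_assoc, transpose_mul]
  have h2 : (B * ((Z * B)ᵀ * Z)).trace = ((Z * B)ᵀ * (Z * B)).trace := by
    rw [trace_mul_comm, Matrix.mul_assoc]
  have h3 : (B * ((Z * B)ᵀ * (Z * B) * Bᵀ)).trace = ((Z * B)ᵀ * (Z * B)).trace := by
    rw [trace_mul_comm, Matrix.mul_assoc, hB, Matrix.mul_one]
  rw [hexp, trace_add, trace_sub, trace_sub, h1, h2, h3] at h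
  linarith

/-- Summation by parts for a nonnegative monotone sequence of weights. -/
lemma sum_mul_nonneg_of_tail_nonneg {n : ℕ} (d a : Fin n → ℝ) (hd : ∀ j, 0 ≤ d j)
    (hmono : Monotone d) (ha : ∀ p : Fin n, 0 ≤ ∑ m, if p ≤ m then a m else 0) :
    0 ≤ ∑ m, d m * a m := by
  induction n with
  | zero => simp
  | succ n ih =>
    have h0 := ha 0
    simp only [Fin.zero_le, if_true] at h0
    have hih := ih (fun m => d m.succ - d 0) (fun m => a m.succ)
      (fun m => sub_nonneg.mpr (hmono (Fin.zero_le _)))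
      (fun i j hij => sub_le_sub_right (hmono (Fin.succ_le_succ_iff.mpr hij)) _)
      (fun p => by simpa [Fin.sum_univ_succ] using ha p.succ)
    have : ∑ m, d m * a m = d 0 * ∑ m, a m + ∑ m : Fin n, (d m.succ - d 0) * a m.succ := by
      simp only [Fin.sum_univ_succ, sub_mul, Finset.sum_sub_distrib, ← Finset.mul_sum]
      ring
    rw [this]
    exact add_nonneg (mul_nonneg (hd 0) h0) hih

lemma rank_diagPair_initial_le {n : ℕ} (p : Fin n) :
    (diagPair fun m => if p ≤ m then (0 : ℝ) else 1).rank ≤ 2 * p := by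
  rw [diagPair_eq_diagonal, rank_diagonal, Fintype.card_subtype, Finset.card_filter,
    Fintype.sum_sum_type]
  have hcard : ∑ m : Fin n, (if m < p then 1 else 0) = (p : ℕ) := by
    rw [← Finset.card_filter, Finset.filter_gt_eq_Iio, Fin.card_Iio]
  simp [two_mul, hcard]

/-- The part of a symplectic matrix supported on the coordinate pairs from `p` on has squared
Frobenius norm at least `2 (k - p)`. -/
lemma Symplectic.le_trace_tail {n k : ℕ} {Y : Matrix (Idx n) (Idx k) ℝ} (hY : Symplectic Y)
    (p : Fin n) :
    2 * ((k : ℝ) - p) ≤ (Yᵀ * diagPair (fun m => if p ≤ m then 1 else 0) * Y).trace := by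
  set E := diagPair (fun m : Fin n => if p ≤ m then (1 : ℝ) else 0) with hE
  set F := diagPair (fun m : Fin n => if p ≤ m then (0 : ℝ) else 1) with hF
  have hET : Eᵀ = E := by rw [hE, diagPair_eq_diagonal, diagonal_transpose]
  have hEE : E * E = E := by
    rw [hE, diagPair_eq_diagonal, diagonal_mul_diagonal]
    congr 1
    ext (m | m) <;> simp
  have hEF : E = 1 - F := by
    rw [hE, hF, diagPair_eq_diagonal, diagPair_eq_diagonal, ← diagonal_one, diagonal_sub]
    congr 1
    ext (m | m) <;> by_cases h : p ≤ m <;> simp [h]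
  have hJE : Jmat n * E = E * Jmat n := Jmat_mul_diagPair _
  obtain ⟨r, B, hB, hFB, hr⟩ := exists_orthonormal_kernel_matrix (F * Y)
  have hrank : (F * Y).rank ≤ 2 * p := (rank_mul_le_left F Y).trans (rank_diagPair_initial_le p)
  have hcard : 2 * k ≤ 2 * (p : ℕ) + r := by
    rw [Fintype.card_sum, Fintype.card_fin] at hr
    omega
  have hcard' : 2 * (k : ℝ) ≤ 2 * p + r := by exact_mod_cast hcard
  have hEYB : E * Y * B = Y * B := by
    rw [hEF, Matrix.sub_mul, Matrix.sub_mul, hFB, Matrix.one_mul, sub_zero]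
  set Z := E * Y with hZ
  have hZZ : Zᵀ * Z = Yᵀ * E * Y := by
    rw [hZ, transpose_mul, hET, Matrix.mul_assoc, ← Matrix.mul_assoc E, hEE, Matrix.mul_assoc]
  have hJB : Zᵀ * Jmat n * Z * B = Jmat k * B := by
    have hY' : Yᵀ * Jmat n * Y = Jmat k := hY
    calc Zᵀ * Jmat n * Z * B = Yᵀ * (E * Jmat n) * (Z * B) := by
          rw [hZ, transpose_mul, hET]; simp only [Matrix.mul_assoc]
      _ = Yᵀ * Jmat n * (E * (E * Y)) * B := by
          rw [← hJE, hZ]; simp only [Matrix.mul_assoc]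
      _ = Yᵀ * Jmat n * Y * B := by
          rw [← Matrix.mul_assoc E E, hEE, Matrix.mul_assoc, ← hZ, hEYB]
          simp only [Matrix.mul_assoc]
      _ = Jmat k * B := by rw [hY']
  have hC : (Jmat k * B)ᵀ * (Jmat k * B) = 1 := by
    rw [transpose_mul, Jmat_transpose, Matrix.mul_assoc, ← Matrix.mul_assoc (-Jmat k),
      Matrix.neg_mul, Jmat_mul_self, neg_neg, Matrix.one_mul, hB]
  have hle1 := trace_compression_le Z B hB
  have hle2 := trace_compression_le Z (Jmat k * B) hC
  have hsq := trace_transpose_mul_self_nonneg (Z * (Jmat k * B) - Jmat n * (Z * B))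
  have hcross : (Z * (Jmat k * B))ᵀ * (Jmat n * (Z * B)) = 1 := by
    calc (Z * (Jmat k * B))ᵀ * (Jmat n * (Z * B))
        = (Jmat k * B)ᵀ * (Zᵀ * Jmat n * Z * B) := by
          simp only [transpose_mul, Matrix.mul_assoc]
      _ = 1 := by rw [hJB, hC]
  have hcross' : (Jmat n * (Z * B))ᵀ * (Z * (Jmat k * B)) = 1 := by
    simpa using congrArg transpose hcross
  have hJJ : (Jmat n * (Z * B))ᵀ * (Jmat n * (Z * B)) = (Z * B)ᵀ * (Z * B) := by
    rw [transpose_mul, Jmat_transpose, Matrix.mul_assoc, ← Matrix.mul_assoc (-Jmat n),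
      Matrix.neg_mul, Jmat_mul_self, neg_neg, Matrix.one_mul]
  rw [transpose_sub, Matrix.sub_mul, Matrix.mul_sub, Matrix.mul_sub, hcross, hcross', hJJ,
    trace_sub, trace_sub, trace_sub, trace_one, Fintype.card_fin] at hsq
  rw [← hZZ]
  linarith

lemma sum_ite_val_lt {n k : ℕ} (hk : k ≤ n) (f : Fin n → ℝ) :
    ∑ m : Fin n, (if (m : ℕ) < k then f m else 0) = ∑ j : Fin k, f (Fin.castLE hk j) := by
  obtain ⟨l, rfl⟩ := Nat.exists_eq_add_of_le hk
  rw [Fin.sum_univ_add]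
  simp
  rfl

lemma sum_ite_le_and_lt {n k : ℕ} (p : Fin n) (hk : k ≤ n) (hp : (p : ℕ) ≤ k) :
    ∑ m : Fin n, (if p ≤ m ∧ (m : ℕ) < k then (1 : ℝ) else 0) = k - p := by
  have h := Fin.sum_univ_eq_sum_range (fun m => if (p : ℕ) ≤ m ∧ m < k then (1 : ℝ) else 0) n
  simp only [Fin.le_def]
  rw [h, ← Finset.sum_filter]
  have hfilter : (Finset.range n).filter (fun m => (p : ℕ) ≤ m ∧ m < k) = Finset.Ico (p : ℕ) k := by
    ext m
    simp only [Finset.mem_filter, Finset.mem_range, Finset.mem_Ico]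
    omega
  rw [hfilter, Finset.sum_const, Nat.card_Ico, nsmul_one, Nat.cast_sub hp]

lemma Symplectic.two_mul_sum_le {n k : ℕ} (hk : k ≤ n) {Y : Matrix (Idx n) (Idx k) ℝ}
    (hY : Symplectic Y) (d : Fin n → ℝ) (hd : ∀ j, 0 ≤ d j) (hmono : Monotone d) :
    2 * ∑ j : Fin k, d (Fin.castLE hk j) ≤ (Yᵀ * diagPair d * Y).trace := by
  rw [trace_transpose_mul_diagPair_mul, ← sum_ite_val_lt hk, Finset.mul_sum, ← sub_nonneg,
    ← Finset.sum_sub_distrib]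
  set w : Fin n → ℝ := fun m => ∑ c, (Y (Sum.inl m) c ^ 2 + Y (Sum.inr m) c ^ 2) with hw
  have hw0 : ∀ m, 0 ≤ w m := fun m => Finset.sum_nonneg fun _ _ => by positivity
  have key := sum_mul_nonneg_of_tail_nonneg d (fun m => w m - if (m : ℕ) < k then 2 else 0)
    hd hmono ?_
  · refine key.trans_eq (Finset.sum_congr rfl fun m _ => ?_)
    split_ifs <;> simp only [hw] <;> ring
  intro p
  rcases le_or_gt k p with hkp | hpk
  · refine Finset.sum_nonneg fun m _ => ?_
    split_ifs with hpm hmk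
    · exact absurd (hkp.trans hpm) hmk.not_ge
    · simpa using hw0 m
    · exact le_rfl
  · have htail := hY.le_trace_tail p
    rw [trace_transpose_mul_diagPair_mul] at htail
    have hcount := sum_ite_le_and_lt p hk hpk.le
    have hsplit : (∑ m, if p ≤ m then w m - (if (m : ℕ) < k then 2 else 0) else 0) =
        ∑ m, (if p ≤ m then 1 else 0) * w m -
          2 * ∑ m : Fin n, (if p ≤ m ∧ (m : ℕ) < k then (1 : ℝ) else 0) := by
      rw [Finset.mul_sum, ← Finset.sum_sub_distrib]
      refine Finset.sum_congr rfl fun m _ => ?_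
      by_cases h1 : p ≤ m <;> by_cases h2 : (m : ℕ) < k <;> simp [h1, h2]
    rw [hsplit, hcount]
    exact sub_nonneg.mpr htail

/-- The inclusion of the first `k` coordinate pairs. -/
def pairInclusion {n k : ℕ} (hk : k ≤ n) : Matrix (Idx n) (Idx k) ℝ :=
  (1 : Matrix (Idx n) (Idx n) ℝ).submatrix id (Sum.map (Fin.castLE hk) (Fin.castLE hk))

lemma pairInclusion_compression {n k : ℕ} (hk : k ≤ n) (A : Matrix (Idx n) (Idx n) ℝ) :
    (pairInclusion hk)ᵀ * A * pairInclusion hk =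
      A.submatrix (Sum.map (Fin.castLE hk) (Fin.castLE hk))
        (Sum.map (Fin.castLE hk) (Fin.castLE hk)) := by
  ext i j
  simp [pairInclusion, mul_apply, one_apply]

lemma symplectic_pairInclusion {n k : ℕ} (hk : k ≤ n) : Symplectic (pairInclusion hk) := by
  rw [Symplectic, pairInclusion_compression]
  ext (i | i) (j | j) <;> simp [Jmat, one_apply]

lemma trace_pairInclusion {n k : ℕ} (hk : k ≤ n) (d : Fin n → ℝ) :
    ((pairInclusion hk)ᵀ * diagPair d * pairInclusion hk).trace =
      2 * ∑ j : Fin k, d (Fin.castLE hk j) := by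
  rw [pairInclusion_compression, diagPair_eq_diagonal]
  simp [trace, two_mul]

/-- for spd `M` with symplectic eigenvalues `d₁ ≤ … ≤ dₙ` and
`1 ≤ k ≤ n`, the minimum of `tr(XᵀMX)` over `Sp(2k,2n)` is attained and
equals `2(d₁ + … + d_k)`. -/
theorem trace_minimization {n k : ℕ} (hk1 : 1 ≤ k) (hk : k ≤ n)
    (M : Matrix (Idx n) (Idx n) ℝ) (hM : M.PosDef)
    (d : Fin n → ℝ) (hd : ∀ j, 0 < d j) (hmono : Monotone d)
    (hW : ∃ S : Matrix (Idx n) (Idx n) ℝ, Symplectic S ∧ Sᵀ * M * S = diagPair d) :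
    IsLeast
      {t : ℝ | ∃ X : Matrix (Idx n) (Idx k) ℝ, Symplectic X ∧ t = (Xᵀ * M * X).trace}
      (2 * ∑ j : Fin k, d (Fin.castLE hk j)) := by
  obtain ⟨S, hS, hSM⟩ := hW
  have htrace : ∀ Y : Matrix (Idx n) (Idx k) ℝ,
      (S * Y)ᵀ * M * (S * Y) = Yᵀ * diagPair d * Y := fun Y => by
    rw [← hSM]
    simp only [transpose_mul, Matrix.mul_assoc]
  constructor
  · exact ⟨S * pairInclusion hk, hS.mul (symplectic_pairInclusion hk), by
      rw [htrace, trace_pairInclusion]⟩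
  · rintro t ⟨X, hX, rfl⟩
    obtain ⟨Y, hY, rfl⟩ := hS.exists_eq_mul hX
    rw [htrace]
    exact hY.two_mul_sum_le hk d (fun j => (hd j).le) hmono
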